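/- arXiv:2102.04240 — 2 statements merged into one kernel-verified Lean document; each statement's English description precedes it below -/
import Mathlib

section
/- If C ⊆ ℝ^n is a convex cone that is a spectrahedral shadow, then its dual cone C* = {y ∈ ℝ^n : ⟨x, y⟩ ≥ 0 for all x ∈ C} is also a spectrahedral shadow. -/
open Matrix
open scoped ComplexOrder

/-- A set `S ⊆ ℝᵏ` is a spectrahedral shadow if it is the image, under a linear map,
of a spectrahedron `{x ∈ ℝⁿ | A₀ + x₁A₁ + ⋯ + xₙAₙ ⪰ 0}` described by Hermitian
matrices `A₀, A₁, …, Aₙ`. -/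
def IsSpectrahedralShadow {k : ℕ} (S : Set (Fin k → ℝ)) : Prop :=
  ∃ (n m : ℕ) (A₀ : Matrix (Fin m) (Fin m) ℂ) (A : Fin n → Matrix (Fin m) (Fin m) ℂ)
    (L : (Fin n → ℝ) →ₗ[ℝ] (Fin k → ℝ)),
    A₀.IsHermitian ∧ (∀ i, (A i).IsHermitian) ∧
      S = L '' {x : Fin n → ℝ | (A₀ + ∑ i, x i • A i).PosSemidef}

/-- Conic duality under a Slater condition: if `P` is an order unit of the cone `Q`, then an affine
functional that is nonnegative on `{w | P + T w ∈ Q}` is represented by a functional nonnegative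
on `Q`. -/
lemma PointedCone.exists_dual_certificate {W H : Type*} [AddCommGroup W] [Module ℝ W]
    [AddCommGroup H] [Module ℝ H] (Q : PointedCone ℝ H) (P : H) (T : W →ₗ[ℝ] H)
    (hPQ : P ∈ Q) (hP : ∀ M, ∃ t : ℝ, 0 ≤ t ∧ M + t • P ∈ Q) (l : W →ₗ[ℝ] ℝ) (a : ℝ)
    (h : ∀ w, P + T w ∈ Q → 0 ≤ a + l w) :
    ∃ φ : H →ₗ[ℝ] ℝ, (∀ M ∈ Q, 0 ≤ φ M) ∧ (∀ w, φ (T w) = l w) ∧ φ P ≤ a := by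
  have smul_mem : ∀ {c : ℝ} {M : H}, 0 ≤ c → M ∈ Q → c • M ∈ Q := fun {c M} hc hM =>
    Q.smul_mem hc hM
  let s : PointedCone ℝ ((W × ℝ) × H) :=
    { carrier := {z | 0 ≤ z.1.2 ∧ z.2 + z.1.2 • P + T z.1.1 ∈ Q}
      add_mem' := by
        rintro ⟨⟨w, t⟩, M⟩ ⟨⟨w', t'⟩, M'⟩ ⟨ht, hz⟩ ⟨ht', hz'⟩
        refine ⟨add_nonneg ht ht', ?_⟩
        convert Q.add_mem hz hz' using 1
        simp only [Prod.mk_add_mk, add_smul, map_add]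
        abel
      zero_mem' := by simp
      smul_mem' := by
        rintro ⟨c, hc⟩ ⟨⟨w, t⟩, M⟩ ⟨ht, hz⟩
        refine ⟨mul_nonneg hc ht, ?_⟩
        convert smul_mem hc hz using 1
        change c • M + (c * t) • P + T (c • w) = _
        simp only [smul_add, map_smul, mul_smul] }
  have mem_s : ∀ w t M, ((w, t), M) ∈ s ↔ 0 ≤ t ∧ M + t • P + T w ∈ Q := fun _ _ _ => Iff.rfl
  let f₀ : ((W × ℝ) × H) →ₗ[ℝ] ℝ :=
    (l ∘ₗ LinearMap.fst ℝ W ℝ + a • LinearMap.snd ℝ W ℝ) ∘ₗ LinearMap.fst ℝ (W × ℝ) H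
  let f : ((W × ℝ) × H) →ₗ.[ℝ] ℝ :=
    ⟨LinearMap.ker (LinearMap.snd ℝ (W × ℝ) H), f₀ ∘ₗ Submodule.subtype _⟩
  have nonneg : ∀ x : f.domain, (x : (W × ℝ) × H) ∈ s → 0 ≤ f x := by
    rintro ⟨⟨⟨w, t⟩, M⟩, hM⟩ hz
    obtain rfl : M = 0 := hM
    obtain ⟨ht, hz⟩ := (mem_s _ _ _).1 hz
    change 0 ≤ l w + a * t
    rw [zero_add] at hz
    rcases ht.eq_or_lt with rfl | ht
    · have hT : T w ∈ Q := by simpa using hz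
      have hall : ∀ c : ℝ, 0 ≤ c → 0 ≤ a + c * l w := fun c hc => by
        simpa using h (c • w) (by simpa using Q.add_mem hPQ (smul_mem hc hT))
      by_contra! hneg
      have hl : l w < 0 := by simpa using hneg
      have ha : 0 ≤ a := by simpa using hall 0 le_rfl
      have := hall ((a + 1) / (-l w)) (by apply div_nonneg <;> linarith)
      rw [div_mul_eq_mul_div, div_neg, mul_div_cancel_right₀ _ hl.ne] at this
      linarith
    · have := h (t⁻¹ • w) (by
        convert smul_mem (inv_nonneg.2 ht.le) hz using 1
        rw [smul_add, smul_smul, inv_mul_cancel₀ ht.ne', one_smul, map_smul])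
      have := mul_nonneg ht.le this
      rw [map_smul, smul_eq_mul, mul_add, mul_inv_cancel_left₀ ht.ne'] at this
      linarith
  have dense : ∀ y, ∃ x : f.domain, (x : (W × ℝ) × H) + y ∈ s := by
    rintro ⟨⟨w, t⟩, M⟩
    obtain ⟨u, hu, hmem⟩ := hP M
    refine ⟨⟨((-w, u - t), 0), rfl⟩, ?_⟩
    change (((-w + w, u - t + t), 0 + M) : (W × ℝ) × H) ∈ s
    rw [mem_s]
    simpa using ⟨hu, hmem⟩
  obtain ⟨g, hg, hgs⟩ := riesz_extension s f nonneg dense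
  have hg' : ∀ w t, g ((w, t), 0) = l w + a * t := fun w t => hg ⟨((w, t), 0), rfl⟩
  have key : ∀ w t M, 0 ≤ t → M + t • P + T w ∈ Q → 0 ≤ l w + a * t + g ((0, 0), M) := by
    intro w t M ht hM
    have := hgs _ ((mem_s w t M).2 ⟨ht, hM⟩)
    rwa [show (((w, t), M) : (W × ℝ) × H) = ((w, t), 0) + ((0, 0), M) by simp, map_add,
      hg'] at this
  have hle : ∀ w, g ((0, 0), T w) ≤ l w := by
    intro w
    have := key w 0 (-T w) le_rfl (by simp)
    rw [show (((0, 0), -T w) : (W × ℝ) × H) = -((0, 0), T w) by simp, map_neg] at this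
    linarith
  refine ⟨g ∘ₗ LinearMap.inr ℝ (W × ℝ) H, fun M hM => ?_, fun w => ?_, ?_⟩
  · change 0 ≤ g ((0, 0), M)
    simpa only [map_zero, mul_zero, add_zero, zero_add] using
      key 0 0 M le_rfl (by simpa using hM)
  · refine le_antisymm (hle w) ?_
    have := hle (-w)
    rw [map_neg, map_neg,
      show (((0, 0), -T w) : (W × ℝ) × H) = -((0, 0), T w) by simp, map_neg] at this
    exact neg_le_neg_iff.1 this
  · have := key 0 1 (-P) zero_le_one (by simp)
    rw [show (((0, 0), -P) : (W × ℝ) × H) = -((0, 0), P) by simp, map_neg] at this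
    simp only [map_zero] at this
    change g ((0, 0), P) ≤ a
    linarith

/-- Spectrahedral shadows may be described over any finite-dimensional parameter space and any
finite matrix index type. -/
lemma isSpectrahedralShadow_image {k : ℕ} {E ι : Type*} [AddCommGroup E] [Module ℝ E]
    [FiniteDimensional ℝ E] [Fintype ι] (A₀ : Matrix ι ι ℂ) (A : E →ₗ[ℝ] Matrix ι ι ℂ)
    (L : E →ₗ[ℝ] (Fin k → ℝ)) (hA₀ : A₀.IsHermitian) (hA : ∀ x, (A x).IsHermitian) :
    IsSpectrahedralShadow (L '' {x | (A₀ + A x).PosSemidef}) := by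
  let b := Module.finBasis ℝ E
  let e := (Fintype.equivFin ι).symm
  refine ⟨_, _, A₀.submatrix e e, fun i => (A (b i)).submatrix e e,
    L ∘ₗ b.equivFun.symm.toLinearMap, hA₀.submatrix e, fun i => (hA _).submatrix e, ?_⟩
  have key : ∀ x, A₀.submatrix e e + ∑ i, x i • (A (b i)).submatrix e e =
      (A₀ + A (b.equivFun.symm x)).submatrix e e := fun x => by
    ext i j
    simp [Module.Basis.equivFun_symm_apply, Matrix.sum_apply]
  simp only [key, Matrix.posSemidef_submatrix_equiv, LinearMap.coe_comp, Set.image_comp]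
  congr 1
  ext x
  simp only [Set.mem_ofPred_eq, Set.mem_image]
  exact ⟨fun hx => ⟨b.equivFun x, by simpa using hx, by simp⟩,
    by rintro ⟨y, hy, rfl⟩; exact hy⟩

namespace Matrix

variable {ι κ : Type*} [Fintype ι] [Fintype κ]

lemma posSemidef_fromBlocks_zero_iff {A : Matrix ι ι ℂ} {D : Matrix κ κ ℂ} :
    (fromBlocks A 0 0 D).PosSemidef ↔ A.PosSemidef ∧ D.PosSemidef := by
  refine ⟨fun h => ⟨h.submatrix Sum.inl, h.submatrix Sum.inr⟩, fun ⟨hA, hD⟩ => ?_⟩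
  refine .of_dotProduct_mulVec_nonneg (hA.1.fromBlocks (by simp) hD.1) fun x => ?_
  have hx : star x ⬝ᵥ (fromBlocks A 0 0 D *ᵥ x) =
      star (x ∘ Sum.inl) ⬝ᵥ (A *ᵥ (x ∘ Sum.inl)) +
        star (x ∘ Sum.inr) ⬝ᵥ (D *ᵥ (x ∘ Sum.inr)) := by
    simp [fromBlocks_mulVec, dotProduct, Fintype.sum_sum_type]
  rw [hx]
  exact add_nonneg (hA.dotProduct_mulVec_nonneg _) (hD.dotProduct_mulVec_nonneg _)

lemma PosSemidef.re_trace_mul_nonneg {A B : Matrix ι ι ℂ} (hA : A.PosSemidef)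
    (hB : B.PosSemidef) : 0 ≤ (A * B).trace.re := by
  classical
  obtain ⟨C, rfl⟩ : ∃ C : Matrix ι ι ℂ, B = Cᴴ * C := by
    open scoped MatrixOrder in
    exact CStarAlgebra.nonneg_iff_eq_star_mul_self.mp hB.nonneg
  rw [← mul_assoc, trace_mul_comm, ← mul_assoc]
  exact (Complex.nonneg_iff.1 (hA.mul_mul_conjTranspose_same C).trace_nonneg).1

/-- The cone of matrices whose real quadratic form is nonnegative on a subspace. -/
def quadCone (V : Submodule ℂ (ι → ℂ)) : PointedCone ℝ (Matrix ι ι ℂ) where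
  carrier := {M | ∀ v ∈ V, 0 ≤ (star v ⬝ᵥ (M *ᵥ v)).re}
  add_mem' := fun hM hN v hv => by
    simpa [add_mulVec, dotProduct_add] using add_nonneg (hM v hv) (hN v hv)
  zero_mem' := fun v _ => by simp
  smul_mem' := by
    rintro ⟨c, hc⟩ M hM v hv
    change 0 ≤ (star v ⬝ᵥ ((c • M) *ᵥ v)).re
    rw [smul_mulVec, dotProduct_smul, Complex.smul_re]
    exact mul_nonneg hc (hM v hv)

lemma mem_quadCone {V : Submodule ℂ (ι → ℂ)} {M : Matrix ι ι ℂ} :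
    M ∈ quadCone V ↔ ∀ v ∈ V, 0 ≤ (star v ⬝ᵥ (M *ᵥ v)).re := Iff.rfl

lemma PosSemidef.mem_quadCone {M : Matrix ι ι ℂ} (hM : M.PosSemidef)
    (V : Submodule ℂ (ι → ℂ)) : M ∈ quadCone V := fun v _ =>
  (Complex.nonneg_iff.1 (hM.dotProduct_mulVec_nonneg v)).1

/-- A positive semidefinite matrix whose kernel meets `V` trivially is an order unit of
`quadCone V`. -/
lemma PosSemidef.exists_add_smul_mem_quadCone {P : Matrix ι ι ℂ} (hP : P.PosSemidef)
    {V : Submodule ℂ (ι → ℂ)} (hV : ∀ v ∈ V, P *ᵥ v = 0 → v = 0) (M : Matrix ι ι ℂ) :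
    ∃ t : ℝ, 0 ≤ t ∧ M + t • P ∈ quadCone V := by
  let q : Matrix ι ι ℂ → (ι → ℂ) → ℝ := fun N v => (star v ⬝ᵥ (N *ᵥ v)).re
  have hq : ∀ N, Continuous (q N) := fun N => by
    unfold q dotProduct mulVec dotProduct
    simp only [Pi.star_apply]
    fun_prop
  have hpos : ∀ v ∈ V, v ≠ 0 → 0 < q P v := by
    intro v hv hv0
    obtain ⟨h1, h2⟩ := Complex.nonneg_iff.1 (hP.dotProduct_mulVec_nonneg v)
    refine lt_of_le_of_ne h1 fun h0 => hv0 (hV v hv ?_)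
    exact (hP.dotProduct_mulVec_zero_iff v).1 (Complex.ext h0.symm h2.symm)
  have hK : IsCompact (Metric.sphere (0 : ι → ℂ) 1 ∩ V) :=
    (isCompact_sphere 0 1).inter_right V.closed_of_finiteDimensional
  have hne : ∀ v ∈ Metric.sphere (0 : ι → ℂ) 1 ∩ V, v ≠ 0 := by
    rintro v ⟨hv, -⟩ rfl
    simp at hv
  obtain ⟨c, hc⟩ := hK.bddBelow_image (f := fun v => q M v / q P v)
    ((hq M).continuousOn.div (hq P).continuousOn fun v hv => (hpos v hv.2 (hne v hv)).ne')
  refine ⟨max 0 (-c), le_max_left _ _, fun v hv => ?_⟩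
  rcases eq_or_ne v 0 with rfl | hv0
  · simp
  have hn : 0 < ‖v‖ := norm_pos_iff.2 hv0
  have hscale : ∀ N, q N ((‖v‖⁻¹ : ℂ) • v) = ‖v‖⁻¹ ^ 2 * q N v := fun N => by
    have : (star ((‖v‖⁻¹ : ℂ) • v) ⬝ᵥ (N *ᵥ ((‖v‖⁻¹ : ℂ) • v))) =
        ((‖v‖⁻¹ ^ 2 : ℝ) : ℂ) * (star v ⬝ᵥ (N *ᵥ v)) := by
      rw [mulVec_smul, star_smul, smul_dotProduct, dotProduct_smul]
      simp [pow_two, mul_assoc]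
    simp only [q, this, Complex.re_ofReal_mul]
  have hmem : (‖v‖⁻¹ : ℂ) • v ∈ Metric.sphere (0 : ι → ℂ) 1 ∩ V :=
    ⟨by simp [norm_smul, hn.ne'], V.smul_mem _ hv⟩
  have h1 : c ≤ q M ((‖v‖⁻¹ : ℂ) • v) / q P ((‖v‖⁻¹ : ℂ) • v) := hc ⟨_, hmem, rfl⟩
  have hPv := hpos v hv hv0
  rw [hscale, hscale, mul_div_mul_left _ _ (by positivity), le_div_iff₀ hPv] at h1
  have h2 : -c * q P v ≤ max 0 (-c) * q P v :=
    mul_le_mul_of_nonneg_right (le_max_right _ _) hPv.le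
  rw [add_mulVec, dotProduct_add, smul_mulVec, dotProduct_smul, Complex.add_re, Complex.smul_re,
    smul_eq_mul]
  change 0 ≤ q M v + max 0 (-c) * q P v
  linarith

/-- A real linear functional that is nonnegative on matrices with nonnegative real quadratic form
is the trace pairing with a positive semidefinite matrix. -/
lemma exists_posSemidef_re_trace_mul (φ : Matrix ι ι ℂ →ₗ[ℝ] ℝ)
    (hφ : ∀ M ∈ quadCone (⊤ : Submodule ℂ (ι → ℂ)), 0 ≤ φ M) :
    ∃ Z : Matrix ι ι ℂ, Z.PosSemidef ∧ ∀ M, φ M = (Z * M).trace.re := by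
  classical
  let ψ : Matrix ι ι ℂ →ₗ[ℂ] ℂ := Module.Dual.extendRCLike (𝕜 := ℂ) φ
  have hre : ∀ M, (ψ M).re = φ M := fun M =>
    Module.Dual.re_extendRCLike_apply (𝕜 := ℂ) φ M
  have him : ∀ M, (ψ M).im = -φ (Complex.I • M) := fun M =>
    Module.Dual.im_extendRCLike_apply (𝕜 := ℂ) φ M
  let Z : Matrix ι ι ℂ := of fun j i => ψ (single i j 1)
  have hψ : ∀ M, ψ M = (Z * M).trace := fun M => by
    conv_lhs => rw [matrix_eq_sum_single M]
    have hs : ∀ i j, single i j (M i j) = M i j • single i j (1 : ℂ) := by simp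
    simp only [map_sum, hs, map_smul, smul_eq_mul, trace, diag_apply, mul_apply, Z, of_apply]
    rw [Finset.sum_comm]
    simp only [mul_comm]
  have hskew : ∀ M : Matrix ι ι ℂ, Mᴴ = -M → φ M = 0 := by
    intro M hM
    have hq : ∀ v, (star v ⬝ᵥ (M *ᵥ v)).re = 0 := fun v => by
      have h1 : star (star v ⬝ᵥ (M *ᵥ v)) = -(star v ⬝ᵥ (M *ᵥ v)) := by
        rw [← star_dotProduct_star, star_star, star_mulVec, hM, vecMul_neg, neg_dotProduct,
          ← dotProduct_mulVec]
      have h2 := congrArg Complex.re h1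
      simp at h2
      linarith
    have h1 := hφ M fun v _ => (hq v).ge
    have h2 := hφ (-M) fun v _ => by simp [neg_mulVec, hq v]
    rw [map_neg] at h2
    linarith
  have hadj : ∀ M, φ Mᴴ = φ M := fun M => by
    have := hskew (Mᴴ - M) (by simp)
    rw [map_sub] at this
    linarith
  have hψadj : ∀ M, ψ Mᴴ = star (ψ M) := fun M => by
    apply Complex.ext
    · simp [hre, hadj]
    · have : Complex.I • Mᴴ = -(Complex.I • M)ᴴ := by
        rw [conjTranspose_smul]; simp
      rw [him, this, map_neg, hadj, neg_neg, Complex.star_def, Complex.conj_im, him, neg_neg]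
  have hZ : Z.IsHermitian := by
    ext i j
    simp [Z, ← hψadj, conjTranspose_single]
  refine ⟨Z, .of_dotProduct_mulVec_nonneg hZ fun v => ?_, fun M => by rw [← hre, hψ]⟩
  have hv : star v ⬝ᵥ (Z *ᵥ v) = ψ (vecMulVec v (star v)) := by
    rw [hψ, mul_vecMulVec, trace_vecMulVec, dotProduct_comm]
  have hpsd := posSemidef_vecMulVec_self_star v
  rw [hv, Complex.nonneg_iff, hre]
  refine ⟨hφ _ (hpsd.mem_quadCone _), ?_⟩
  have := congrArg Complex.im (hψadj (vecMulVec v (star v)))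
  rw [show (vecMulVec v (star v))ᴴ = _ from hpsd.1] at this
  simp at this
  linarith

end Matrix

section Spectrahedron

variable {E ι : Type*} [AddCommGroup E] [Module ℝ E] [Fintype ι]

/-- A nonempty spectrahedron has a point at which the kernel of the pencil is contained in the
kernel at every other point. -/
lemma exists_minimal_kernel (A₀ : Matrix ι ι ℂ) (T : E →ₗ[ℝ] Matrix ι ι ℂ)
    (hne : ∃ x, (A₀ + T x).PosSemidef) :
    ∃ x₀, (A₀ + T x₀).PosSemidef ∧ ∀ x, (A₀ + T x).PosSemidef →
      ∀ v, (A₀ + T x₀) *ᵥ v = 0 → (A₀ + T x) *ᵥ v = 0 := by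
  let K : E → Submodule ℂ (ι → ℂ) := fun x => LinearMap.ker (A₀ + T x).mulVecLin
  have mem_K : ∀ x v, v ∈ K x ↔ (A₀ + T x) *ᵥ v = 0 := fun _ _ => Iff.rfl
  obtain ⟨x₀, hx₀, hmin⟩ := WellFounded.has_min
    (InvImage.wf (fun x => Module.finrank ℂ (K x)) wellFounded_lt)
    {x | (A₀ + T x).PosSemidef} hne
  refine ⟨x₀, hx₀, fun x hx => ?_⟩
  let z : E := (1 / 2 : ℝ) • x₀ + (1 / 2 : ℝ) • x
  have hzeq : A₀ + T z = (1 / 2 : ℝ) • ((A₀ + T x₀) + (A₀ + T x)) := by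
    simp only [z, map_add, map_smul]
    module
  have hz : (A₀ + T z).PosSemidef := hzeq ▸ (hx₀.add hx).smul (by norm_num)
  have hker : ∀ v ∈ K z, (A₀ + T x₀) *ᵥ v = 0 ∧ (A₀ + T x) *ᵥ v = 0 := by
    intro v hv
    have h0 : star v ⬝ᵥ ((A₀ + T x₀) *ᵥ v) + star v ⬝ᵥ ((A₀ + T x) *ᵥ v) = 0 := by
      rw [mem_K, hzeq, smul_mulVec, smul_eq_zero] at hv
      rw [← dotProduct_add, ← add_mulVec, hv.resolve_left (by norm_num), dotProduct_zero]
    rw [add_eq_zero_iff_of_nonneg (hx₀.dotProduct_mulVec_nonneg v)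
      (hx.dotProduct_mulVec_nonneg v)] at h0
    exact ⟨(hx₀.dotProduct_mulVec_zero_iff v).1 h0.1, (hx.dotProduct_mulVec_zero_iff v).1 h0.2⟩
  have hK : K z = K x₀ := Submodule.eq_of_le_of_finrank_le (fun v hv => (hker v hv).1)
    (not_lt.1 (hmin z hz))
  intro v hv
  exact (hker v (hK ▸ (mem_K x₀ v).2 hv)).2

/-- Exact semidefinite duality after facial reduction: linear functionals nonnegative on a
nonempty spectrahedron are certified by positive semidefinite matrices. -/
lemma exists_nonneg_on_spectrahedron_iff (A₀ : Matrix ι ι ℂ) (T : E →ₗ[ℝ] Matrix ι ι ℂ)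
    (hT : ∀ x, (T x).IsHermitian) (hne : ∃ x, (A₀ + T x).PosSemidef) :
    ∃ (x₀ : E) (W : Submodule ℝ E), ∀ l : E →ₗ[ℝ] ℝ,
      (∀ x, (A₀ + T x).PosSemidef → 0 ≤ l x) ↔
        ∃ Z : Matrix ι ι ℂ, Z.PosSemidef ∧ (∀ w ∈ W, (Z * T w).trace.re = l w) ∧
          (Z * (A₀ + T x₀)).trace.re ≤ l x₀ := by
  obtain ⟨x₀, hP, hker⟩ := exists_minimal_kernel A₀ T hne
  set P := A₀ + T x₀ with hPdef
  let K : Submodule ℂ (ι → ℂ) := LinearMap.ker P.mulVecLin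
  have mem_K : ∀ v, v ∈ K ↔ P *ᵥ v = 0 := fun _ => Iff.rfl
  let W : Submodule ℝ E :=
    { carrier := {w | ∀ v ∈ K, T w *ᵥ v = 0}
      add_mem' := fun ha hb v hv => by rw [map_add, add_mulVec, ha v hv, hb v hv, add_zero]
      zero_mem' := fun v _ => by simp
      smul_mem' := fun c w hw v hv => by rw [map_smul, smul_mulVec, hw v hv, smul_zero] }
  refine ⟨x₀, W, fun l => ⟨fun hl => ?_, ?_⟩⟩
  · obtain ⟨V, hV⟩ := K.exists_isCompl
    have hPV : ∀ v ∈ V, P *ᵥ v = 0 → v = 0 := fun v hv h0 =>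
      Submodule.disjoint_def.1 hV.disjoint v h0 hv
    have hpsd : ∀ w ∈ W, P + T w ∈ quadCone V → (P + T w).PosSemidef := by
      intro w hw hq
      have hH : (P + T w).IsHermitian := hP.1.add (hT w)
      refine .of_dotProduct_mulVec_nonneg hH fun v => ?_
      obtain ⟨a, ha, b, hb, rfl⟩ := Submodule.mem_sup.1
        (hV.sup_eq_top ▸ Submodule.mem_top : v ∈ K ⊔ V)
      have h0 : (P + T w) *ᵥ a = 0 := by
        rw [add_mulVec, (mem_K a).1 ha, hw a ha, add_zero]
      have h0' : star a ᵥ* (P + T w) = 0 := by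
        have := congrArg star h0
        rwa [star_mulVec, hH.eq, star_zero] at this
      rw [mulVec_add, h0, zero_add, star_add, add_dotProduct, dotProduct_mulVec, h0',
        zero_dotProduct, zero_add, Complex.nonneg_iff]
      exact ⟨hq b hb, (hH.im_star_dotProduct_mulVec_self b).symm⟩
    obtain ⟨φ, hφ, hφT, hφP⟩ := PointedCone.exists_dual_certificate (quadCone V) P
      (T ∘ₗ W.subtype) (hP.mem_quadCone V) (hP.exists_add_smul_mem_quadCone hPV)
      (l ∘ₗ W.subtype) (l x₀) (by
        rintro ⟨w, hw⟩ hq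
        have := hl (x₀ + w) (by rw [map_add, ← add_assoc]; exact hpsd w hw hq)
        rwa [map_add] at this)
    obtain ⟨Z, hZ, hφZ⟩ := exists_posSemidef_re_trace_mul φ
      fun M hM => hφ M fun v _ => hM v Submodule.mem_top
    exact ⟨Z, hZ, fun w hw => (hφZ _).symm.trans (hφT ⟨w, hw⟩), hφZ P ▸ hφP⟩
  · rintro ⟨Z, hZ, hW, hle⟩ x hx
    have hw : x - x₀ ∈ W := fun v hv => by
      have h : T (x - x₀) = (A₀ + T x) - P := by rw [map_sub, hPdef]; abel
      rw [h, sub_mulVec, hker x hx v hv, (mem_K v).1 hv, sub_zero]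
    have h1 := hW _ hw
    have h2 := hZ.re_trace_mul_nonneg hx
    have h3 : A₀ + T x = P + T (x - x₀) := by rw [map_sub, hPdef]; abel
    rw [h3, mul_add, trace_add, Complex.add_re, h1, map_sub] at h2
    linarith

end Spectrahedron

/-- If a convex cone `C ⊆ ℝⁿ` is a spectrahedral shadow, then so is its dual cone
`C* = {y | ⟨x, y⟩ ≥ 0 for all x ∈ C}`. -/
theorem dual_of_spectrahedral_shadow (n : ℕ) (C : Set (Fin n → ℝ))
    (hconv : Convex ℝ C) (hcone : ∀ c : ℝ, 0 ≤ c → ∀ x ∈ C, c • x ∈ C)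
    (hC : IsSpectrahedralShadow C) :
    IsSpectrahedralShadow {y : Fin n → ℝ | ∀ x ∈ C, 0 ≤ ∑ i, x i * y i} := by
  obtain ⟨p, m, A₀, A, L, -, hA, rfl⟩ := hC
  let T : (Fin p → ℝ) →ₗ[ℝ] Matrix (Fin m) (Fin m) ℂ := Fintype.linearCombination ℝ A
  have hTx : ∀ x, T x = ∑ i, x i • A i := fun _ => rfl
  have hT : ∀ x, (T x).IsHermitian := fun x => by
    rw [hTx, IsHermitian, conjTranspose_sum]
    simp [conjTranspose_smul, (hA _).eq]
  by_cases hne : ∃ x, (A₀ + T x).PosSemidef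
  · obtain ⟨x₀, W, hdual⟩ := exists_nonneg_on_spectrahedron_iff A₀ T hT hne
    let F : Submodule ℝ ((Fin n → ℝ) × Matrix (Fin m) (Fin m) ℂ) :=
      { carrier := {z | z.2.IsHermitian ∧ ∀ w ∈ W, (z.2 * T w).trace.re = L w ⬝ᵥ z.1}
        add_mem' := fun ha hb => ⟨ha.1.add hb.1, fun w hw => by
          simp [add_mul, ha.2 w hw, hb.2 w hw]⟩
        zero_mem' := by simp
        smul_mem' := fun c z hz => ⟨by
          simp [IsHermitian, conjTranspose_smul, hz.1.eq], fun w hw => by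
          simp [hz.2 w hw]⟩ }
    let B : F →ₗ[ℝ] Matrix (Fin m ⊕ Unit) (Fin m ⊕ Unit) ℂ :=
      { toFun := fun z => fromBlocks z.1.2 0 0
          (diagonal fun _ => ((L x₀ ⬝ᵥ z.1.1 - (z.1.2 * (A₀ + T x₀)).trace.re : ℝ) : ℂ))
        map_add' := fun a b => by
          rw [fromBlocks_add, diagonal_add]
          congr 2
          · simp
          · simp
          · funext _
            simp [add_mul]
            ring
        map_smul' := fun c a => by
          rw [fromBlocks_smul, ← diagonal_smul]
          congr 2
          · simp
          · simp
          · funext _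
            simp [mul_sub] }
    have hB : ∀ z : F, (B z).PosSemidef ↔
        z.1.2.PosSemidef ∧ (z.1.2 * (A₀ + T x₀)).trace.re ≤ L x₀ ⬝ᵥ z.1.1 := fun z => by
      refine posSemidef_fromBlocks_zero_iff.trans (and_congr_right fun _ => ?_)
      rw [posSemidef_diagonal_iff]
      simp only [Complex.zero_le_real, sub_nonneg, forall_const]
    convert isSpectrahedralShadow_image 0 B (LinearMap.fst ℝ _ _ ∘ₗ F.subtype)
      isHermitian_zero (fun z => z.2.1.fromBlocks (by simp)
        (isHermitian_diagonal_of_self_adjoint _ (by ext; simp))) using 1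
    ext y
    have hy := hdual ((dotProductBilin ℝ ℝ).flip y ∘ₗ L)
    have hl : ∀ x, ((dotProductBilin ℝ ℝ).flip y ∘ₗ L) x = L x ⬝ᵥ y := fun _ => rfl
    simp only [hl] at hy
    simp only [zero_add, hB]
    refine Set.forall_mem_image.trans (hy.trans ⟨?_, ?_⟩)
    · rintro ⟨Z, hZ, hW, hle⟩
      exact ⟨⟨(y, Z), hZ.1, hW⟩, ⟨hZ, hle⟩, rfl⟩
    · rintro ⟨⟨⟨y, Z⟩, hZH, hW⟩, ⟨hZ, hle⟩, rfl⟩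
      exact ⟨Z, hZ, hW, hle⟩
  · convert isSpectrahedralShadow_image (0 : Matrix (Fin 0) (Fin 0) ℂ) 0
      (LinearMap.id : (Fin n → ℝ) →ₗ[ℝ] _) isHermitian_zero fun _ => isHermitian_zero using 1
    have hempty : {x : Fin p → ℝ | (A₀ + ∑ i, x i • A i).PosSemidef} = ∅ :=
      Set.eq_empty_of_forall_notMem fun x hx => hne ⟨x, hx⟩
    ext y
    simp [hempty, PosSemidef.zero]
end

section
/- The separable rank cannot be upper bounded by any function of the purification rank alone: for every function f : ℕ → ℕ there exist d ∈ ℕ and a separable positive semidefinite matrix ρ ∈ Her_d ⊗ Her_d ≅ Her_{d²} such that sep-rank(ρ) > f(puri-rank(ρ)). -/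
open Matrix
open scoped Kronecker ComplexOrder

/-- `ρ ∈ Mat_d ⊗ Mat_d` is separable if it is a sum of Kronecker products of positive
semidefinite matrices. -/
def SeparableMat {d : ℕ} (ρ : Matrix (Fin d × Fin d) (Fin d × Fin d) ℂ) : Prop :=
  ∃ (r : ℕ) (a b : Fin r → Matrix (Fin d) (Fin d) ℂ),
    (∀ i, (a i).PosSemidef) ∧ (∀ i, (b i).PosSemidef) ∧ ρ = ∑ i, a i ⊗ₖ b i

/-- The separable rank of `ρ`: the minimal number of terms in a separable decomposition
`ρ = Σᵢ aᵢ ⊗ bᵢ` with all `aᵢ, bᵢ` positive semidefinite. -/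
noncomputable def sepRank {d : ℕ} (ρ : Matrix (Fin d × Fin d) (Fin d × Fin d) ℂ) : ℕ :=
  sInf {r | ∃ a b : Fin r → Matrix (Fin d) (Fin d) ℂ,
    (∀ i, (a i).PosSemidef) ∧ (∀ i, (b i).PosSemidef) ∧ ρ = ∑ i, a i ⊗ₖ b i}

/-- The purification rank of `ρ`: the minimal `r` such that `ρ = ξξ*` for some
`ξ = Σᵢ aᵢ ⊗ bᵢ` with `aᵢ ∈ Mat_{d,e}(ℂ)`, `bᵢ ∈ Mat_{d,f}(ℂ)`, `i = 1, …, r`. -/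
noncomputable def puriRank {d : ℕ} (ρ : Matrix (Fin d × Fin d) (Fin d × Fin d) ℂ) : ℕ :=
  sInf {r | ∃ (e f : ℕ) (a : Fin r → Matrix (Fin d) (Fin e) ℂ)
    (b : Fin r → Matrix (Fin d) (Fin f) ℂ),
    ρ = (∑ i, a i ⊗ₖ b i) * (∑ i, a i ⊗ₖ b i)ᴴ}

/-- If `diag(c)` for a function `c` vanishing exactly on the diagonal of `Fin d × Fin d` has a
separable decomposition with `r` terms, then `d ≤ 2 ^ r`: the supports of the rows of the
resulting nonnegative factorization of `c` are pairwise distinct. -/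
lemma le_two_pow_of_diagonal_eq_sum_kronecker {d r : ℕ} {c : Fin d × Fin d → ℂ}
    (hc : ∀ i j, c (i, j) = 0 ↔ i = j) {a b : Fin r → Matrix (Fin d) (Fin d) ℂ}
    (ha : ∀ k, (a k).PosSemidef) (hb : ∀ k, (b k).PosSemidef)
    (h : diagonal c = ∑ k, a k ⊗ₖ b k) : d ≤ 2 ^ r := by
  have hsum (i j : Fin d) : c (i, j) = ∑ k, a k i i * b k j j := by
    simpa [Matrix.sum_apply] using congr_fun (congr_fun h (i, j)) (i, j)
  have hinj : Function.Injective
      fun i : Fin d => Finset.univ.filter fun k => a k i i ≠ 0 := by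
    intro i j hij
    by_contra hne
    have hpos : ∑ k, a k i i * b k j j ≠ 0 := by
      rw [← hsum]
      exact fun h0 => hne ((hc i j).1 h0)
    obtain ⟨k, -, hk⟩ := Finset.exists_ne_zero_of_sum_ne_zero hpos
    have hkj : a k j j ≠ 0 := by
      have hmem := Finset.ext_iff.1 hij k
      simp only [Finset.mem_filter, Finset.mem_univ, true_and] at hmem
      exact hmem.1 (left_ne_zero_of_mul hk)
    have hzero : ∑ k, a k j j * b k j j = 0 := by rw [← hsum, hc]
    have hterm := (Finset.sum_eq_zero_iff_of_nonneg fun l _ =>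
      mul_nonneg ((ha l).diag_nonneg (i := j)) ((hb l).diag_nonneg (i := j))).1 hzero k
        (Finset.mem_univ k)
    exact mul_ne_zero hkj (right_ne_zero_of_mul hk) hterm
  simpa using Fintype.card_le_of_injective _ hinj

/-- A nonnegative diagonal matrix is separable. -/
lemma separableMat_diagonal {d : ℕ} {c : Fin d × Fin d → ℂ} (hc : ∀ p, 0 ≤ c p) :
    SeparableMat (diagonal c) := by
  refine ⟨d, fun i => diagonal (Pi.single i 1), fun i => diagonal fun j => c (i, j),
    fun i => ?_, fun i => ?_, ?_⟩
  · exact PosSemidef.diagonal (Pi.single_nonneg.2 zero_le_one)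
  · exact PosSemidef.diagonal fun j => hc (i, j)
  · ext ⟨i, j⟩ ⟨k, l⟩
    simp only [diagonal_kronecker_diagonal, Matrix.sum_apply, diagonal_apply]
    split_ifs <;> simp [Pi.single_apply]

/-- The matrix `diag((xᵢ - xⱼ)²)` has purification rank at most two, because `(xᵢ - xⱼ)`
has rank at most two. -/
lemma puriRank_diagonal_sub_sq_le {d : ℕ} (x : Fin d → ℝ) :
    puriRank (diagonal fun p : Fin d × Fin d => ((x p.1 : ℂ) - x p.2) ^ 2) ≤ 2 := by
  refine Nat.sInf_le ⟨d, d, ![diagonal fun i => (x i : ℂ), 1], ![1, diagonal fun i => -(x i : ℂ)],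
    ?_⟩
  have hξ : (∑ k, (![diagonal fun i => (x i : ℂ), 1] : Fin 2 → Matrix (Fin d) (Fin d) ℂ) k ⊗ₖ
      (![1, diagonal fun i => -(x i : ℂ)] : Fin 2 → Matrix (Fin d) (Fin d) ℂ) k) =
      diagonal fun p : Fin d × Fin d => (x p.1 : ℂ) - x p.2 := by
    simp only [Fin.sum_univ_two, cons_val_zero, cons_val_one, ← diagonal_one,
      diagonal_kronecker_diagonal, diagonal_add]
    congr 1
    ext p
    ring
  rw [hξ, diagonal_conjTranspose, diagonal_mul_diagonal]
  congr 1
  ext p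
  simp [sq]

/-- The separable rank cannot be upper bounded by any function of the purification rank
alone. -/
theorem sepRank_not_bounded_by_puriRank (f : ℕ → ℕ) :
    ∃ (d : ℕ) (ρ : Matrix (Fin d × Fin d) (Fin d × Fin d) ℂ),
      ρ.PosSemidef ∧ SeparableMat ρ ∧ f (puriRank ρ) < sepRank ρ := by
  set N := f 0 + f 1 + f 2 with hN
  let x : Fin (2 ^ (N + 1)) → ℝ := fun i => (i : ℕ)
  let c : Fin (2 ^ (N + 1)) × Fin (2 ^ (N + 1)) → ℂ := fun p => ((x p.1 : ℂ) - x p.2) ^ 2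
  have hc (p) : 0 ≤ c p := by
    have : c p = (((x p.1 - x p.2) ^ 2 : ℝ) : ℂ) := by simp [c]
    rw [this]
    exact Complex.zero_le_real.2 (sq_nonneg _)
  have hc0 (i j) : c (i, j) = 0 ↔ i = j := by
    simp [c, x, sub_eq_zero, Fin.ext_iff]
  have hsep : SeparableMat (diagonal c) := separableMat_diagonal hc
  refine ⟨_, diagonal c, PosSemidef.diagonal hc, hsep, ?_⟩
  have hpuri : puriRank (diagonal c) ≤ 2 := puriRank_diagonal_sub_sq_le x
  have hf : f (puriRank (diagonal c)) ≤ N := by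
    interval_cases puriRank (diagonal c) <;> omega
  obtain ⟨a, b, ha, hb, hab⟩ := Nat.sInf_mem hsep
  have hle := le_two_pow_of_diagonal_eq_sum_kronecker hc0 ha hb hab
  exact hf.trans_lt ((Nat.pow_le_pow_iff_right one_lt_two).1 hle)
end
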